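/- Let W be a finite subset of ℤ^d such that W ≼ σ·W for every permutation σ ∈ S_d (for example, W = ord(P) for a smooth Fano d-polytope P). Then every presubset V of W satisfies V ≼ σ·V for every σ ∈ S_d; that is, V is the minimal element of the set {σ·V | σ ∈ S_d} with respect to the order ≼ on finite subsets of ℤ^d. -/

import Mathlib

open Set

noncomputable section

/-- The total order `≼` on `ℤ^d`: `x ≼ y` iff
`(-x 0 - … - x (d-1), x 0, …, x (d-1)) ≤ (-y 0 - … - y (d-1), y 0, …, y (d-1))`
lexicographically in `ℤ^(d+1)`. -/
def VOrder {d : ℕ} (x y : Fin d → ℤ) : Prop :=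
  toLex (Fin.cons (-(∑ i, x i)) x : Fin (d + 1) → ℤ) ≤
    toLex (Fin.cons (-(∑ i, y i)) y : Fin (d + 1) → ℤ)

/-- The action of a permutation `σ ∈ S_d` on `ℤ^d`, sending
`a_1 e_1 + … + a_d e_d` to `a_1 e_{σ(1)} + … + a_d e_{σ(d)}`. -/
def permAct {d : ℕ} (σ : Equiv.Perm (Fin d)) (a : Fin d → ℤ) : Fin d → ℤ :=
  fun j => a (σ.symm j)

/-- The recursively defined order `≼` on finite subsets of `ℤ^d`:
`X ≼ Y` iff `X = ∅`, or `Y ≠ ∅` and either `min X ≺ min Y`, or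
`min X = min Y` and `X ∖ {min X} ≼ Y ∖ {min Y}` (where `min` is taken with
respect to the total order `≼` on `ℤ^d`, i.e. it is the element of the set
below all elements of the set). -/
inductive FinsetOrder {d : ℕ} : Finset (Fin d → ℤ) → Finset (Fin d → ℤ) → Prop
  | empty (Y : Finset (Fin d → ℤ)) : FinsetOrder ∅ Y
  | min_lt {X Y : Finset (Fin d → ℤ)} {x y : Fin d → ℤ} :
      x ∈ X → (∀ x' ∈ X, VOrder x x') →
      y ∈ Y → (∀ y' ∈ Y, VOrder y y') →
      VOrder x y → x ≠ y → FinsetOrder X Y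
  | min_eq {X Y : Finset (Fin d → ℤ)} {x : Fin d → ℤ} :
      x ∈ X → (∀ x' ∈ X, VOrder x x') →
      x ∈ Y → (∀ y' ∈ Y, VOrder x y') →
      FinsetOrder (X.erase x) (Y.erase x) → FinsetOrder X Y

/-- `V` is a presubset of `W`: `V ⊆ W` and `v ≺ w` whenever `v ∈ V` and `w ∈ W ∖ V`. -/
def IsPresubsetOf {d : ℕ} (V W : Finset (Fin d → ℤ)) : Prop :=
  V ⊆ W ∧ ∀ v ∈ V, ∀ w ∈ W, w ∉ V → VOrder v w ∧ v ≠ w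

theorem VOrder_inj_aux {d : ℕ} {x y : Fin d → ℤ} (h : VOrder x y) (h' : VOrder y x) : x = y := by
  have h1 := le_antisymm h h'
  have h2 := toLex.injective h1
  exact (Fin.cons_inj.mp h2).2

theorem VOrder_trans_aux {d : ℕ} {x y z : Fin d → ℤ} (h : VOrder x y) (h' : VOrder y z) :
    VOrder x z := le_trans h h'

theorem exists_min_aux {d : ℕ} (U : Finset (Fin d → ℤ)) (hU : U.Nonempty) :
    ∃ u ∈ U, ∀ u' ∈ U, VOrder u u' :=
  U.exists_min_image
    (fun x => toLex (Fin.cons (-(∑ i, x i)) x : Fin (d + 1) → ℤ)) hU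

theorem mem_presubset_aux {d : ℕ} {V X : Finset (Fin d → ℤ)} {x : Fin d → ℤ}
    (hV : IsPresubsetOf V X) (hne : V.Nonempty) (hx : x ∈ X) (hmin : ∀ x' ∈ X, VOrder x x') :
    x ∈ V := by
  by_contra hxV
  obtain ⟨v, hv⟩ := hne
  obtain ⟨h1, h2⟩ := hV.2 v hv x hx hxV
  exact h2 (VOrder_inj_aux h1 (hmin v (hV.1 hv)))

theorem finsetOrder_aux {d : ℕ} {X Y : Finset (Fin d → ℤ)} (h : FinsetOrder X Y) :
    ∀ V U : Finset (Fin d → ℤ), IsPresubsetOf V X → U ⊆ Y → V.card ≤ U.card →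
      FinsetOrder V U := by
  induction h with
  | empty Y =>
    intro V U hV _ _
    rw [Finset.subset_empty.mp hV.1]
    exact .empty U
  | @min_lt X Y x y hx hxm hy hym hxy hne =>
    intro V U hV hU hc
    rcases V.eq_empty_or_nonempty with rfl | hVne
    · exact .empty U
    have hxV := mem_presubset_aux hV hVne hx hxm
    obtain ⟨u, hu, hum⟩ := exists_min_aux U (Finset.card_pos.mp (hVne.card_pos.trans_le hc))
    refine .min_lt hxV (fun x' h' => hxm x' (hV.1 h')) hu hum
      (VOrder_trans_aux hxy (hym u (hU hu))) ?_
    rintro rfl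
    exact hne (VOrder_inj_aux hxy (hym x (hU hu)))
  | @min_eq X Y x hx hxm hy hym _ ih =>
    intro V U hV hU hc
    rcases V.eq_empty_or_nonempty with rfl | hVne
    · exact .empty U
    have hxV := mem_presubset_aux hV hVne hx hxm
    obtain ⟨u, hu, hum⟩ := exists_min_aux U (Finset.card_pos.mp (hVne.card_pos.trans_le hc))
    by_cases hxu : x = u
    · subst hxu
      refine .min_eq hxV (fun x' h' => hxm x' (hV.1 h')) hu hum
        (ih _ _ ⟨Finset.erase_subset_erase _ hV.1, ?_⟩ (Finset.erase_subset_erase _ hU) ?_)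
      · intro v hv w hw hwV
        rw [Finset.mem_erase] at hv hw hwV
        exact hV.2 v hv.2 w hw.2 (fun h => hwV ⟨hw.1, h⟩)
      · rw [Finset.card_erase_of_mem hxV, Finset.card_erase_of_mem hu]
        omega
    · exact .min_lt hxV (fun x' h' => hxm x' (hV.1 h')) hu hum (hym u (hU hu)) hxu

theorem permAct_injective_aux {d : ℕ} (σ : Equiv.Perm (Fin d)) :
    Function.Injective (permAct σ) := by
  intro a b h
  funext j
  have := congrFun h (σ j)
  simpa [permAct] using this

/-- Lemma 13: if `W` is a finite subset of `ℤ^d` with `W ≼ σ·W` for all `σ ∈ S_d`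
(e.g. `W = ord(P)` for a smooth Fano `d`-polytope `P`), then every presubset `V`
of `W` satisfies `V ≼ σ·V` for every `σ ∈ S_d`, i.e. `V` is the minimal element
of `{σ·V | σ ∈ S_d}`. -/
theorem presubset_is_minimal {d : ℕ} {W : Finset (Fin d → ℤ)}
    (hW : ∀ σ : Equiv.Perm (Fin d), FinsetOrder W (W.image (permAct σ)))
    {V : Finset (Fin d → ℤ)} (hV : IsPresubsetOf V W) :
    ∀ σ : Equiv.Perm (Fin d), FinsetOrder V (V.image (permAct σ)) := by
  intro σ
  exact finsetOrder_aux (hW σ) V _ hV (Finset.image_subset_image hV.1)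
    (Finset.card_image_of_injective V (permAct_injective_aux σ)).ge
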